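/- Let K be the Klein bottle group, realized as the semidirect product ℤ ⋊ ℤ in which the generator of the second factor acts on ℤ by negation, and set a = (1, 0) and b = (0, 1). Then b² lies in the centralizer Z({a}) but b does not lie in Z({a}). Consequently K does not satisfy Property N. -/

import Mathlib

/-- The action of the generator of the second `ℤ` factor on the first: the
nontrivial automorphism (negation, written multiplicatively as inversion). -/
def kleinAction : Multiplicative ℤ →* MulAut (Multiplicative ℤ) :=
  zpowersHom (MulAut (Multiplicative ℤ)) (MulEquiv.inv (Multiplicative ℤ))

/-- The Klein bottle group `K = ⟨a, b | b a b⁻¹ = a⁻¹⟩`, realized as the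
semidirect product `ℤ ⋊ ℤ` in which the generator of the second factor acts on
`ℤ` by negation. -/
abbrev KleinBottleGroup : Type :=
  SemidirectProduct (Multiplicative ℤ) (Multiplicative ℤ) kleinAction

/-- The element `a = (1, 0)` of the Klein bottle group. -/
def kleinA : KleinBottleGroup := SemidirectProduct.inl (Multiplicative.ofAdd (1 : ℤ))

/-- The element `b = (0, 1)` of the Klein bottle group. -/
def kleinB : KleinBottleGroup := SemidirectProduct.inr (Multiplicative.ofAdd (1 : ℤ))

theorem klein_act_one (x : Multiplicative ℤ) :
    kleinAction (Multiplicative.ofAdd (1 : ℤ)) x = x⁻¹ := by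
  simp [kleinAction, zpowersHom_apply]

theorem klein_rel : kleinB * kleinA = kleinA⁻¹ * kleinB := by
  ext
  · simp [kleinA, kleinB, klein_act_one]
  · simp [kleinA, kleinB]

theorem klein_sq : kleinB ^ 2 ∈ Subgroup.centralizer {kleinA} := by
  rw [Subgroup.mem_centralizer_singleton_iff]
  have h : kleinB * kleinA⁻¹ = kleinA * kleinB := by
    rw [mul_inv_eq_iff_eq_mul, mul_assoc, klein_rel, mul_inv_cancel_left]
  first
  | rw [pow_two, mul_assoc, klein_rel, ← mul_assoc, h, mul_assoc]
  | (symm; rw [pow_two, mul_assoc, klein_rel, ← mul_assoc, h, mul_assoc])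

theorem klein_not : kleinB ∉ Subgroup.centralizer {kleinA} := by
  rw [Subgroup.mem_centralizer_singleton_iff]
  intro h
  have h1 : kleinA⁻¹ * kleinB = kleinA * kleinB := by
    rw [← klein_rel]
    first
    | exact h
    | exact h.symm
  have h2 := congrArg SemidirectProduct.left (mul_right_cancel h1)
  simp only [kleinA, ← map_inv, SemidirectProduct.left_inl] at h2
  have h3 := congrArg Multiplicative.toAdd h2
  simp at h3
  try omega

/-- In the Klein bottle group, `b²` lies in the centralizer `Z({a})` but `b`
does not; consequently the Klein bottle group does not satisfy Property N. -/
theorem stmt9 :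
    kleinB ^ 2 ∈ Subgroup.centralizer {kleinA} ∧
    kleinB ∉ Subgroup.centralizer {kleinA} ∧
    ¬ (∀ (x : KleinBottleGroup) (S : Finset KleinBottleGroup) (n : ℕ), 1 ≤ n →
        x ^ n ∈ Subgroup.centralizer (S : Set KleinBottleGroup) →
        x ∈ Subgroup.centralizer (S : Set KleinBottleGroup)) := by
  refine ⟨klein_sq, klein_not, fun h => klein_not ?_⟩
  have := h kleinB {kleinA} 2 (by norm_num) (by simpa only [Finset.coe_singleton] using klein_sq)
  simpa only [Finset.coe_singleton] using this
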